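/- Let a = (a_1 ≥ ... ≥ a_n), b = (b_1 ≥ ... ≥ b_n), and c = (c_1 ≥ ... ≥ c_n) be weakly decreasing sequences of nonnegative real numbers. Then the following are equivalent: (a) there exist n×n complex Hermitian matrices A, B, C with eigenvalues a_1,...,a_n, b_1,...,b_n, and c_1,...,c_n respectively, such that C ≤ A + B; (b) there exist an integer s ≥ 1, real numbers t(ℓ) ∈ [0,1] for 1 ≤ ℓ ≤ s, a decomposition n = Σ_{ℓ=1}^s n(ℓ) into positive integers, and complex Hermitian n(ℓ)×n(ℓ) matrices A(ℓ), B(ℓ), C(ℓ) for 1 ≤ ℓ ≤ s with C(ℓ) = t(ℓ)(A(ℓ) + B(ℓ)), such that there is no nonzero proper subspace of ℂ^{n(ℓ)} invariant under both A(ℓ) and B(ℓ), and the eigenvalues (with multiplicity) of the block-diagonal direct sums ⊕_ℓ A(ℓ), ⊕_ℓ B(ℓ), ⊕_ℓ C(ℓ) are a_1,...,a_n, b_1,...,b_n, and c_1,...,c_n respectively. -/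

import Mathlib

open scoped ComplexOrder

/-- `M` is a Hermitian matrix whose eigenvalues, with multiplicity, are `{μ i : i}`. -/
def HasEigs {ι : Type} [Fintype ι] [DecidableEq ι] (M : Matrix ι ι ℂ) (μ : ι → ℝ) : Prop :=
  ∃ U : Matrix ι ι ℂ, U * U.conjTranspose = 1 ∧ U.conjTranspose * U = 1 ∧
    M = U * Matrix.diagonal (fun i => (μ i : ℂ)) * U.conjTranspose

/-- `X` has singular values `s 1 ≥ s 2 ≥ ... ≥ s q ≥ 0` where `q = min(#rows, #cols)`:
`s` is weakly decreasing and nonnegative on `1..q`, and the eigenvalues of `Xᴴ * X`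
are `s 1 ^ 2, ..., s q ^ 2` together with `#cols - q` zeros. -/
def HasSVals {ι κ : Type} [Fintype ι] [Fintype κ] [DecidableEq κ]
    (X : Matrix ι κ ℂ) (q : ℕ) (s : ℕ → ℝ) : Prop :=
  q = min (Fintype.card ι) (Fintype.card κ) ∧
  (∀ a b, 1 ≤ a → a ≤ b → b ≤ q → s b ≤ s a) ∧
  (∀ a, 1 ≤ a → a ≤ q → 0 ≤ s a) ∧
  ∃ e : κ ≃ Fin (Fintype.card κ),
    HasEigs (X.conjTranspose * X)
      (fun j => if (e j : ℕ) + 1 ≤ q then s ((e j : ℕ) + 1) ^ 2 else 0)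

section Eigs

variable {ι : Type} [Fintype ι] [DecidableEq ι]

open Matrix Polynomial

theorem HasEigs.charpoly_eq {M : Matrix ι ι ℂ} {μ : ι → ℝ} (h : HasEigs M μ) :
    M.charpoly = ∏ i, (X - C (μ i : ℂ)) := by
  obtain ⟨U, -, hU, rfl⟩ := h
  rw [charpoly_mul_comm, ← mul_assoc, hU, one_mul, charpoly_diagonal]

theorem isHermitian_diagonal_ofReal {ι : Type} [DecidableEq ι] (μ : ι → ℝ) :
    (diagonal fun i => (μ i : ℂ)).IsHermitian :=
  isHermitian_diagonal_iff.2 fun i => by simp [isSelfAdjoint_iff]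

theorem HasEigs.isHermitian {M : Matrix ι ι ℂ} {μ : ι → ℝ} (h : HasEigs M μ) :
    M.IsHermitian := by
  obtain ⟨U, -, -, rfl⟩ := h
  exact isHermitian_mul_mul_conjTranspose U (isHermitian_diagonal_ofReal μ)

theorem HasEigs.posSemidef {M : Matrix ι ι ℂ} {μ : ι → ℝ} (h : HasEigs M μ)
    (hμ : ∀ i, 0 ≤ μ i) : M.PosSemidef := by
  obtain ⟨U, -, -, rfl⟩ := h
  refine PosSemidef.mul_mul_conjTranspose_same (PosSemidef.diagonal fun i => ?_) U
  simpa using hμ i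

theorem Matrix.IsHermitian.exists_conj_eq_of_charpoly_eq {M N : Matrix ι ι ℂ}
    (hM : M.IsHermitian) (hN : N.IsHermitian) (h : M.charpoly = N.charpoly) :
    ∃ U ∈ unitary (Matrix ι ι ℂ), M = U * N * star U := by
  have hMs := hM.spectral_theorem
  rw [(hM.eigenvalues_eq_eigenvalues_iff hN).2 h] at hMs
  have hNs := hN.conjStarAlgAut_star_eigenvectorUnitary
  rw [← hNs, ← Unitary.conjStarAlgAut_mul_apply, Unitary.conjStarAlgAut_apply] at hMs
  exact ⟨_, SetLike.coe_mem _, hMs⟩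

theorem Matrix.IsHermitian.hasEigs {M : Matrix ι ι ℂ} {μ : ι → ℝ} (hM : M.IsHermitian)
    (h : M.charpoly = ∏ i, (X - C (μ i : ℂ))) : HasEigs M μ := by
  obtain ⟨U, hU, hMU⟩ := hM.exists_conj_eq_of_charpoly_eq (isHermitian_diagonal_ofReal μ)
    (h.trans (charpoly_diagonal _).symm)
  exact ⟨U, Unitary.mul_star_self_of_mem hU, Unitary.star_mul_self_of_mem hU, hMU⟩

theorem charpoly_conj_unitary {U : Matrix ι ι ℂ} (hU : U ∈ unitary (Matrix ι ι ℂ))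
    (M : Matrix ι ι ℂ) : (U * M * star U).charpoly = M.charpoly := by
  rw [charpoly_mul_comm, ← mul_assoc, Unitary.star_mul_self_of_mem hU, one_mul]

theorem charpoly_blockDiagonal'_fin {s : ℕ} {m : Fin s → Type}
    [∀ k, Fintype (m k)] [∀ k, DecidableEq (m k)] (M : ∀ k, Matrix (m k) (m k) ℂ) :
    (blockDiagonal' M).charpoly = ∏ k, (M k).charpoly := by
  rw [Matrix.charpoly, (blockTriangular_blockDiagonal' M).charmatrix.det_fintype]
  refine Finset.prod_congr rfl fun k _ => ?_
  rw [Matrix.charpoly, ← det_submatrix_equiv_self (Equiv.sigmaSubtype k).symm]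
  congr 1
  ext1 i j
  have hcoe (i : m k) : ((Equiv.sigmaSubtype k).symm i : (l : Fin s) × m l) = ⟨k, i⟩ := rfl
  by_cases h : i = j <;> simp [toSquareBlock_def, charmatrix_apply, diagonal_apply, hcoe, h]

end Eigs

section Commutant

variable {ι : Type} [Fintype ι] [DecidableEq ι]

open Matrix

/-- Every Hermitian matrix commuting with `A`, `B` and `C` is scalar. -/
def HasScalarCommutant (A B C : Matrix ι ι ℂ) : Prop :=
  ∀ H : Matrix ι ι ℂ, H.IsHermitian → Commute H A → Commute H B → Commute H C →
    ∃ z : ℂ, H = z • 1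

theorem HasScalarCommutant.exists_eq_smul_one {A B C H : Matrix ι ι ℂ}
    (h : HasScalarCommutant A B C) (hA : A.IsHermitian) (hB : B.IsHermitian)
    (hC : C.IsHermitian) (hHA : Commute H A) (hHB : Commute H B) (hHC : Commute H C) :
    ∃ z : ℂ, H = z • 1 := by
  have hstar {M : Matrix ι ι ℂ} (hM : M.IsHermitian) (hHM : Commute H M) : Commute Hᴴ M := by
    have := hHM.star_star
    rwa [star_eq_conjTranspose, star_eq_conjTranspose, hM.eq] at this
  obtain ⟨z, hz⟩ := h (H + Hᴴ) (isHermitian_add_transpose_self H)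
    (hHA.add_left (hstar hA hHA)) (hHB.add_left (hstar hB hHB)) (hHC.add_left (hstar hC hHC))
  obtain ⟨w, hw⟩ := h (Complex.I • (H - Hᴴ))
    (by simp [IsHermitian, conjTranspose_smul, ← smul_neg])
    ((hHA.sub_left (hstar hA hHA)).smul_left _) ((hHB.sub_left (hstar hB hHB)).smul_left _)
    ((hHC.sub_left (hstar hC hHC)).smul_left _)
  refine ⟨(1 / 2) * (z - Complex.I * w), ?_⟩
  rw [mul_smul, sub_smul, mul_smul, ← hz, ← hw, smul_smul, Complex.I_mul_I]
  module

/-- Traceless Hermitian matrices are sums of infinitesimal unitary conjugations of `A`, `B`, `C`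
when these have no common reduction. -/
theorem HasScalarCommutant.exists_skewAdjoint_commutators {A B C E : Matrix ι ι ℂ}
    (h : HasScalarCommutant A B C) (hA : A.IsHermitian) (hB : B.IsHermitian)
    (hC : C.IsHermitian) (hE : E.IsHermitian) (htr : E.trace = 0) :
    ∃ X ∈ skewAdjoint (Matrix ι ι ℂ), ∃ Y ∈ skewAdjoint (Matrix ι ι ℂ),
      ∃ Z ∈ skewAdjoint (Matrix ι ι ℂ),
        E = (X * A - A * X) + (Y * B - B * Y) - (Z * C - C * Z) := by
  let ad (M : Matrix ι ι ℂ) : Matrix ι ι ℂ →ₗ[ℂ] Matrix ι ι ℂ :=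
    LinearMap.mulRight ℂ M - LinearMap.mulLeft ℂ M
  let R := LinearMap.range (ad A) ⊔ LinearMap.range (ad B) ⊔ LinearMap.range (ad C)
  have hER : E ∈ R := by
    by_contra hER
    obtain ⟨f, hfE, hfR⟩ := Submodule.exists_le_ker_of_notMem hER
    let H : Matrix ι ι ℂ := Matrix.of fun i j => f (Matrix.single j i 1)
    have hf (M : Matrix ι ι ℂ) : f M = (H * M).trace := by
      conv_lhs => rw [matrix_eq_sum_single M]
      rw [trace, Finset.sum_comm]
      simp only [map_sum, diag_apply, mul_apply, H, of_apply]
      refine Finset.sum_congr rfl fun i _ => Finset.sum_congr rfl fun j _ => ?_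
      rw [← mul_one (M j i), ← smul_eq_mul, ← smul_single, map_smul, smul_eq_mul, smul_eq_mul]
      ring
    have hcomm {M : Matrix ι ι ℂ} (hM : LinearMap.range (ad M) ≤ R) : Commute H M := by
      refine (ext_iff_trace_mul_right.2 fun X => ?_ : H * M = M * H)
      have hX : f (X * M - M * X) = 0 := hfR (hM ⟨X, rfl⟩)
      rw [hf, mul_sub, trace_sub, sub_eq_zero] at hX
      rw [mul_assoc, ← hX, ← mul_assoc, trace_mul_comm, mul_assoc]
    obtain ⟨z, hz⟩ := h.exists_eq_smul_one hA hB hC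
      (hcomm (le_sup_left.trans le_sup_left)) (hcomm (le_sup_right.trans le_sup_left))
      (hcomm le_sup_right)
    exact hfE (by rw [hf, hz, smul_mul_assoc, one_mul, trace_smul, htr, smul_zero])
  obtain ⟨_, hAB, _, ⟨Z, rfl⟩, hsum⟩ := Submodule.mem_sup.1 hER
  obtain ⟨_, ⟨X, rfl⟩, _, ⟨Y, rfl⟩, rfl⟩ := Submodule.mem_sup.1 hAB
  have hskew (X : Matrix ι ι ℂ) :
      (1 / 2 : ℝ) • (X - star X) ∈ skewAdjoint (Matrix ι ι ℂ) := by
    rw [skewAdjoint.mem_iff, star_smul, star_sub, star_star, star_trivial, ← smul_neg, neg_sub]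
  refine ⟨_, hskew X, _, hskew Y, _, hskew (-Z), ?_⟩
  have hEstar : star E = E := hE
  have hAs : star A = A := hA
  have hBs : star B = B := hB
  have hCs : star C = C := hC
  have hsum' : (X * A - A * X) + (Y * B - B * Y) + (Z * C - C * Z) = E := hsum
  have hdouble : E = (1 / 2 : ℝ) • (E + star E) := by rw [hEstar]; module
  rw [hdouble, ← hsum']
  simp only [star_add, star_sub, star_mul, hAs, hBs, hCs, star_neg, smul_mul_assoc,
    mul_smul_comm, sub_mul, mul_sub, neg_mul, mul_neg]
  module

end Commutant

section Perturbation

variable {ι : Type} [Fintype ι] [DecidableEq ι]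

open Matrix
open scoped MatrixOrder Matrix.Norms.L2Operator

theorem hasDerivAt_conj_exp {X : Matrix ι ι ℂ} (hX : X ∈ skewAdjoint (Matrix ι ι ℂ))
    (A : Matrix ι ι ℂ) :
    HasDerivAt (fun s : ℝ => NormedSpace.exp (s • X) * A * star (NormedSpace.exp (s • X)))
      (X * A - A * X) 0 := by
  have hexp : HasDerivAt (fun s : ℝ => NormedSpace.exp (s • X)) X 0 := by
    simpa using hasDerivAt_exp_smul_const X (0 : ℝ)
  have h := (hexp.mul_const A).mul hexp.star
  have hderiv : X * A * star (NormedSpace.exp ((0 : ℝ) • X)) +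
      NormedSpace.exp ((0 : ℝ) • X) * A * star X = X * A - A * X := by
    simp [skewAdjoint.mem_iff.1 hX, sub_eq_add_neg]
  rw [hderiv] at h
  exact h

theorem exp_smul_mem_unitary {X : Matrix ι ι ℂ} (hX : X ∈ skewAdjoint (Matrix ι ι ℂ))
    (s : ℝ) : NormedSpace.exp (s • X) ∈ unitary (Matrix ι ι ℂ) :=
  letI : NormedAlgebra ℚ (Matrix ι ι ℂ) := NormedAlgebra.restrictScalars ℚ ℂ _
  NormedSpace.exp_mem_unitary_of_mem_skewAdjoint (skewAdjoint.smul_mem s hX)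

/-- If `A + B - C` is positive semidefinite and nonzero, and `A`, `B`, `C` have no common
reduction, then independent unitary conjugations make it positive definite. -/
theorem HasScalarCommutant.exists_conj_sub_posSemidef {A B C : Matrix ι ι ℂ}
    (h : HasScalarCommutant A B C) (hA : A.IsHermitian) (hB : B.IsHermitian)
    (hC : C.IsHermitian) (hD : (A + B - C).PosSemidef) (hD0 : A + B - C ≠ 0) :
    ∃ U ∈ unitary (Matrix ι ι ℂ), ∃ V ∈ unitary (Matrix ι ι ℂ),
      ∃ W ∈ unitary (Matrix ι ι ℂ), ∃ ε : ℝ, 0 < ε ∧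
        (U * A * star U + V * B * star V - W * C * star W - ε • 1).PosSemidef := by
  set D := A + B - C with hDdef
  have hne : Nonempty ι := by
    by_contra hempty
    rw [not_nonempty_iff] at hempty
    exact hD0 (Subsingleton.elim _ _)
  obtain ⟨r, hr0, hr⟩ : ∃ r : ℝ, 0 < r ∧ D.trace = r := by
    have h0 := hD.trace_nonneg
    have h1 : D.trace ≠ 0 := fun h => hD0 (hD.trace_eq_zero_iff.1 h)
    refine ⟨D.trace.re, (Complex.pos_iff.1 (lt_of_le_of_ne h0 h1.symm)).1, ?_⟩
    exact Complex.ext rfl (by simpa using (Complex.nonneg_iff.1 h0).2.symm)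
  set τ : ℝ := r / Fintype.card ι
  have hτ : 0 < τ := by positivity
  obtain ⟨X, hX, Y, hY, Z, hZ, hE⟩ := h.exists_skewAdjoint_commutators (E := τ • 1 - D) hA hB hC
    (by
      refine IsHermitian.sub ?_ hD.isHermitian
      simp [IsHermitian, conjTranspose_smul])
    (by
      rw [trace_sub, trace_smul, trace_one, hr, Complex.real_smul, ← Complex.ofReal_natCast,
        ← Complex.ofReal_mul, div_mul_cancel₀ _ (by positivity), sub_self])
  let F (s : ℝ) : Matrix ι ι ℂ :=
    NormedSpace.exp (s • X) * A * star (NormedSpace.exp (s • X)) +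
      NormedSpace.exp (s • Y) * B * star (NormedSpace.exp (s • Y)) -
      NormedSpace.exp (s • Z) * C * star (NormedSpace.exp (s • Z))
  have hF : HasDerivAt F (τ • 1 - D) 0 := by
    rw [hE]
    exact ((hasDerivAt_conj_exp hX A).add (hasDerivAt_conj_exp hY B)).sub
      (hasDerivAt_conj_exp hZ C)
  have hF0 : F 0 = D := by simp [F, hDdef]
  have hev := (hasDerivAt_iff_isLittleO.1 hF).def (half_pos hτ)
  obtain ⟨s, hs, hs0, hs1⟩ :=
    ((hev.filter_mono nhdsWithin_le_nhds).and (Ioo_mem_nhdsGT (zero_lt_one (α := ℝ)))).exists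
  refine ⟨_, exp_smul_mem_unitary hX s, _, exp_smul_mem_unitary hY s, _,
    exp_smul_mem_unitary hZ s, s * (τ / 2), by positivity, ?_⟩
  change (F s - (s * (τ / 2)) • 1).PosSemidef
  simp only [hF0, sub_zero, Real.norm_eq_abs, abs_of_pos hs0] at hs
  set N := F s - D - s • (τ • 1 - D)
  have hconj (U : Matrix ι ι ℂ) {M : Matrix ι ι ℂ} (hM : M.IsHermitian) :
      IsSelfAdjoint (U * M * star U) := isHermitian_mul_mul_conjTranspose U hM
  have hDsa : IsSelfAdjoint D := hD.isHermitian
  have hFsa : IsSelfAdjoint (F s) := ((hconj _ hA).add (hconj _ hB)).sub (hconj _ hC)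
  have hNsa : IsSelfAdjoint N :=
    (hFsa.sub hDsa).sub
      ((IsSelfAdjoint.all s).smul (((IsSelfAdjoint.all τ).smul (.one _)).sub hDsa))
  have hNle := hNsa.neg_algebraMap_norm_le_self
  rw [Algebra.algebraMap_eq_smul_one] at hNle
  rw [← nonneg_iff_posSemidef]
  have hN1 : (0 : Matrix ι ι ℂ) ≤ (τ / 2 * s - ‖N‖) • 1 :=
    smul_nonneg (sub_nonneg.2 hs) zero_le_one
  have hD1 : (0 : Matrix ι ι ℂ) ≤ (1 - s) • D :=
    smul_nonneg (sub_nonneg.2 hs1.le) hD.nonneg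
  have hN2 : (0 : Matrix ι ι ℂ) ≤ N + ‖N‖ • 1 := by
    simpa [add_comm] using sub_nonneg.2 hNle
  have hsum := add_nonneg (add_nonneg hN1 hN2) hD1
  have heq : F s - (s * (τ / 2)) • 1 = (τ / 2 * s - ‖N‖) • 1 + (N + ‖N‖ • 1) + (1 - s) • D := by
    simp only [N]
    module
  rwa [heq]

/-- A Hermitian matrix is bounded above by its norm. -/
theorem exists_pos_smul_one_sub_posSemidef {M : Matrix ι ι ℂ} (hM : M.IsHermitian) {ε r : ℝ}
    (hε : 0 < ε) (hr : 0 < r) :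
    ∃ δ : ℝ, 0 < δ ∧ δ ≤ r ∧ (ε • 1 - δ • M).PosSemidef := by
  have hMle : M ≤ ‖M‖ • 1 := by
    have := IsSelfAdjoint.le_algebraMap_norm_self (a := M) hM
    rwa [Algebra.algebraMap_eq_smul_one] at this
  refine ⟨min r (ε / (‖M‖ + 1)), by positivity, min_le_left _ _, ?_⟩
  set δ := min r (ε / (‖M‖ + 1))
  have hδ : 0 < δ := by positivity
  have hδM : δ * ‖M‖ ≤ ε := by
    have h1 : δ * (‖M‖ + 1) ≤ ε := (le_div_iff₀ (by positivity)).1 (min_le_right _ _)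
    linarith
  rw [← nonneg_iff_posSemidef]
  have h1 : (0 : Matrix ι ι ℂ) ≤ (ε - δ * ‖M‖) • 1 := smul_nonneg (sub_nonneg.2 hδM) zero_le_one
  have h2 : (0 : Matrix ι ι ℂ) ≤ δ • (‖M‖ • 1 - M) := smul_nonneg hδ.le (sub_nonneg.2 hMle)
  have heq : ε • (1 : Matrix ι ι ℂ) - δ • M = (ε - δ * ‖M‖) • 1 + δ • (‖M‖ • 1 - M) := by module
  rw [heq]
  exact add_nonneg h1 h2

end Perturbation

section Minimal

variable {ι : Type} [Fintype ι] [DecidableEq ι]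

open Matrix
open scoped MatrixOrder Matrix.Norms.L2Operator

theorem isCompact_unitary_matrix : IsCompact (unitary (Matrix ι ι ℂ) : Set (Matrix ι ι ℂ)) := by
  have : ProperSpace (Matrix ι ι ℂ) := FiniteDimensional.proper ℂ _
  refine Metric.isCompact_of_isClosed_isBounded isClosed_unitary
    (isBounded_iff_forall_norm_le.2 ⟨1, fun U hU => ?_⟩)
  rcases subsingleton_or_nontrivial (Matrix ι ι ℂ) with _ | _
  · simp [Subsingleton.elim U 0]
  · exact (CStarRing.norm_of_mem_unitary hU).le

/-- `t` is a scale at which `C ≤ t • (A + B)` holds after suitable unitary conjugations. -/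
def IsDominatingScale (A B C : Matrix ι ι ℂ) (t : ℝ) : Prop :=
  ∃ U ∈ unitary (Matrix ι ι ℂ), ∃ V ∈ unitary (Matrix ι ι ℂ), ∃ W ∈ unitary (Matrix ι ι ℂ),
    (t • (U * A * star U + V * B * star V) - W * C * star W).PosSemidef

theorem exists_isLeast_isDominatingScale {A B C : Matrix ι ι ℂ} (h : (A + B - C).PosSemidef) :
    ∃ t, IsLeast {t | t ∈ Set.Icc (0 : ℝ) 1 ∧ IsDominatingScale A B C t} t := by
  let 𝓤 : Set (Matrix ι ι ℂ) := unitary (Matrix ι ι ℂ)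
  let g (x : (Matrix ι ι ℂ × Matrix ι ι ℂ × Matrix ι ι ℂ) × ℝ) : Matrix ι ι ℂ :=
    x.2 • (x.1.1 * A * star x.1.1 + x.1.2.1 * B * star x.1.2.1) - x.1.2.2 * C * star x.1.2.2
  have hg : Continuous g := by fun_prop
  have hclosed : IsClosed (g ⁻¹' {M | 0 ≤ M}) := isClosed_Ici.preimage hg
  have hK := ((isCompact_unitary_matrix.prod (isCompact_unitary_matrix.prod
    isCompact_unitary_matrix)).prod (isCompact_Icc (a := (0 : ℝ)) (b := 1))).inter_right hclosed
    |>.image continuous_snd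
  have himage : {t | t ∈ Set.Icc (0 : ℝ) 1 ∧ IsDominatingScale A B C t} =
      Prod.snd '' ((𝓤 ×ˢ 𝓤 ×ˢ 𝓤) ×ˢ Set.Icc (0 : ℝ) 1 ∩ g ⁻¹' {M | 0 ≤ M}) := by
    ext t
    constructor
    · rintro ⟨ht, U, hU, V, hV, W, hW, hpos⟩
      exact ⟨((U, V, W), t), ⟨⟨⟨hU, hV, hW⟩, ht⟩, nonneg_iff_posSemidef.2 hpos⟩, rfl⟩
    · rintro ⟨⟨⟨U, V, W⟩, t⟩, ⟨⟨⟨hU, hV, hW⟩, ht⟩, hpos⟩, rfl⟩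
      exact ⟨ht, U, hU, V, hV, W, hW, nonneg_iff_posSemidef.1 hpos⟩
  rw [himage]
  refine hK.exists_isLeast ?_
  rw [← himage]
  exact ⟨1, by simp, 1, one_mem _, 1, one_mem _, 1, one_mem _, by simpa using h⟩

/-- At the least dominating scale, matrices without common reduction satisfy equality. -/
theorem HasScalarCommutant.eq_smul_add_of_isLeast {A B C : Matrix ι ι ℂ} {t : ℝ}
    (h : HasScalarCommutant A B C) (hA : A.IsHermitian) (hB : B.IsHermitian)
    (hC : C.PosSemidef) (hpos : (t • (A + B) - C).PosSemidef)
    (ht : IsLeast {t | t ∈ Set.Icc (0 : ℝ) 1 ∧ IsDominatingScale A B C t} t) :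
    C = t • (A + B) := by
  by_contra hne
  have hne' : t • (A + B) - C ≠ 0 := fun h0 => hne (sub_eq_zero.1 h0).symm
  have ht0 : 0 < t := by
    refine lt_of_le_of_ne ht.1.1.1 fun h0 => hne ?_
    rw [← h0, zero_smul, zero_sub] at hpos
    rw [← h0, zero_smul]
    exact le_antisymm (neg_nonneg.1 hpos.nonneg) hC.nonneg
  have hcomm {H M : Matrix ι ι ℂ} (hHM : Commute H (t • M)) : Commute H M := by
    simpa [smul_smul, inv_mul_cancel₀ ht0.ne'] using hHM.smul_right t⁻¹
  have hscal : HasScalarCommutant (t • A) (t • B) C := fun H hH hHA hHB hHC =>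
    h H hH (hcomm hHA) (hcomm hHB) hHC
  rw [smul_add] at hpos hne'
  have hsa : IsSelfAdjoint t := IsSelfAdjoint.all t
  obtain ⟨U, hU, V, hV, W, hW, ε, hε, hpos'⟩ :=
    hscal.exists_conj_sub_posSemidef (hA.smul hsa) (hB.smul hsa) hC.isHermitian hpos hne'
  obtain ⟨δ, hδ, hδt, hδpos⟩ := exists_pos_smul_one_sub_posSemidef
    ((isHermitian_mul_mul_conjTranspose U hA).add (isHermitian_mul_mul_conjTranspose V hB)) hε ht0
  have hle := ht.2 ⟨⟨sub_nonneg.2 hδt, by linarith [ht.1.1.2]⟩, U, hU, V, hV, W, hW, by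
    convert hpos'.add hδpos using 1
    simp only [mul_smul_comm, smul_mul_assoc, star_eq_conjTranspose]
    module⟩
  linarith

end Minimal

section Split

variable {ι : Type} [Fintype ι] [DecidableEq ι]

open Matrix

theorem Matrix.IsHermitian.exists_eigenvalues_ne {H : Matrix ι ι ℂ} (hH : H.IsHermitian)
    (h : ¬∃ z : ℂ, H = z • 1) : ∃ i j, hH.eigenvalues i ≠ hH.eigenvalues j := by
  by_contra! hall
  refine h ?_
  rcases isEmpty_or_nonempty ι with hι | ⟨⟨i⟩⟩
  · exact ⟨0, Subsingleton.elim _ _⟩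
  · refine ⟨hH.eigenvalues i, ?_⟩
    have hd : diagonal (RCLike.ofReal ∘ hH.eigenvalues : ι → ℂ) =
        (hH.eigenvalues i : ℂ) • 1 := by
      rw [smul_one_eq_diagonal]
      congr 1
      ext j
      simp [hall j i]
    conv_lhs => rw [hH.spectral_theorem, hd, map_smul, map_one]

/-- Hermitian matrices commuting with a common nonscalar Hermitian matrix are simultaneously
unitarily equivalent to block diagonal matrices with two blocks. -/
theorem exists_blocks_of_not_hasScalarCommutant {A B C : Matrix ι ι ℂ}
    (h : ¬HasScalarCommutant A B C) :
    ∃ k l : ℕ, 0 < k ∧ 0 < l ∧ k + l = Fintype.card ι ∧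
      ∃ (P : Matrix ι (Fin k) ℂ) (Q : Matrix ι (Fin l) ℂ), ∀ M ∈ ({A, B, C} : Set (Matrix ι ι ℂ)),
        M.charpoly = (Pᴴ * M * P).charpoly * (Qᴴ * M * Q).charpoly := by
  simp only [HasScalarCommutant, not_forall] at h
  obtain ⟨H, hH, hHA, hHB, hHC, hns⟩ := h
  obtain ⟨i₀, j₀, hne⟩ := hH.exists_eigenvalues_ne hns
  set p : ι → Prop := fun i => hH.eigenvalues i = hH.eigenvalues j₀ with hp
  set U : Matrix ι ι ℂ := (hH.eigenvectorUnitary : Matrix ι ι ℂ)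
  have hU : U ∈ unitary (Matrix ι ι ℂ) := SetLike.coe_mem _
  let e : Fin (Fintype.card {i // p i}) ⊕ Fin (Fintype.card {i // ¬p i}) ≃ ι :=
    (Equiv.sumCongr (Fintype.equivFin _).symm (Fintype.equivFin _).symm).trans (Equiv.sumCompl p)
  have hel (i) : p (e (Sum.inl i)) := ((Fintype.equivFin {i // p i}).symm i).2
  have her (i) : ¬p (e (Sum.inr i)) := ((Fintype.equivFin {i // ¬p i}).symm i).2
  refine ⟨_, _, Fintype.card_pos_iff.2 ⟨⟨j₀, rfl⟩⟩, Fintype.card_pos_iff.2 ⟨⟨i₀, hne⟩⟩, ?_,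
    U.submatrix id (e ∘ Sum.inl), U.submatrix id (e ∘ Sum.inr), fun M hM => ?_⟩
  · simpa using Fintype.card_congr e
  have hHM : Commute H M := by
    rcases hM with rfl | rfl | rfl
    exacts [hHA, hHB, hHC]
  have hdiag : Commute (diagonal (RCLike.ofReal ∘ hH.eigenvalues : ι → ℂ)) (Uᴴ * M * U) := by
    have := hHM.map (Unitary.conjStarAlgAut ℂ _ (star hH.eigenvectorUnitary))
    rwa [hH.conjStarAlgAut_star_eigenvectorUnitary, Unitary.conjStarAlgAut_star_apply] at this
  have hzero {i j} (hi : p i) (hj : ¬p j) : (Uᴴ * M * U) i j = 0 := by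
    have hij := congr_fun₂ hdiag.eq i j
    rw [diagonal_mul, mul_diagonal, mul_comm, ← sub_eq_zero, ← mul_sub] at hij
    refine (mul_eq_zero.1 hij).resolve_right (sub_ne_zero.2 fun h => hj ?_)
    have h' : hH.eigenvalues i = hH.eigenvalues j := by simpa using h
    exact h'.symm.trans hi
  have hblocks : reindex e.symm e.symm (Uᴴ * M * U) = fromBlocks
      ((U.submatrix id (e ∘ Sum.inl))ᴴ * M * U.submatrix id (e ∘ Sum.inl)) 0
      ((U.submatrix id (e ∘ Sum.inr))ᴴ * M * U.submatrix id (e ∘ Sum.inl))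
      ((U.submatrix id (e ∘ Sum.inr))ᴴ * M * U.submatrix id (e ∘ Sum.inr)) := by
    ext (i | i) (j | j)
    · rfl
    · exact hzero (hel i) (her j)
    · rfl
    · rfl
  rw [← charpoly_fromBlocks_zero₁₂, ← hblocks, charpoly_reindex]
  have := charpoly_conj_unitary (Unitary.star_mem hU) M
  rw [star_star] at this
  exact this.symm

end Split

section Decomposition

open Matrix

/-- The orthogonal projection onto a subspace, as a matrix. -/
theorem exists_isHermitian_projection {ι : Type} [Fintype ι] [DecidableEq ι]
    (L : Submodule ℂ (ι → ℂ)) :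
    ∃ P : Matrix ι ι ℂ, P.IsHermitian ∧ (∀ v, P *ᵥ v ∈ L) ∧ ∀ v ∈ L, P *ᵥ v = v := by
  let K : Submodule ℂ (EuclideanSpace ℂ ι) :=
    L.comap (WithLp.linearEquiv 2 ℂ (ι → ℂ)).toLinearMap
  let P : Matrix ι ι ℂ := (toEuclideanCLM (n := ι) (𝕜 := ℂ)).symm K.starProjection
  have hP : toEuclideanCLM (n := ι) (𝕜 := ℂ) P = K.starProjection :=
    StarAlgEquiv.apply_symm_apply ..
  have hmul (v : ι → ℂ) : P *ᵥ v = (K.starProjection (WithLp.toLp 2 v)).ofLp := by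
    rw [← hP, toEuclideanCLM_toLp]
  refine ⟨P, ?_, fun v => ?_, fun v hv => ?_⟩
  · have hsa : IsSelfAdjoint K.starProjection := isSelfAdjoint_starProjection K
    refine EquivLike.injective (toEuclideanCLM (n := ι) (𝕜 := ℂ)) ?_
    rw [← star_eq_conjTranspose, map_star, hP, hsa.star_eq]
  · rw [hmul]
    exact K.starProjection_apply_mem (WithLp.toLp 2 v)
  · rw [hmul, K.starProjection_eq_self_iff.2 (show WithLp.toLp 2 v ∈ K from hv)]

theorem HasScalarCommutant.eq_bot_or_eq_top {ι : Type} [Fintype ι] [DecidableEq ι]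
    {A B : Matrix ι ι ℂ} {t : ℝ} (h : HasScalarCommutant A B (t • (A + B)))
    (hA : A.IsHermitian) (hB : B.IsHermitian) (L : Submodule ℂ (ι → ℂ))
    (hLA : ∀ v ∈ L, A *ᵥ v ∈ L) (hLB : ∀ v ∈ L, B *ᵥ v ∈ L) : L = ⊥ ∨ L = ⊤ := by
  obtain ⟨P, hP, hmem, hfix⟩ := exists_isHermitian_projection L
  have hcomm {M : Matrix ι ι ℂ} (hM : M.IsHermitian) (hLM : ∀ v ∈ L, M *ᵥ v ∈ L) :
      Commute P M := by
    have h1 : P * M * P = M * P := by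
      refine ext_iff_mulVec.2 fun v => ?_
      rw [mul_assoc, ← mulVec_mulVec, ← mulVec_mulVec, hfix _ (hLM _ (hmem v))]
    have h2 : P * M * P = P * M := by
      have := congr_arg conjTranspose h1
      simpa only [conjTranspose_mul, hP.eq, hM.eq, ← mul_assoc] using this
    exact h2.symm.trans h1
  have hPA := hcomm hA hLA
  have hPB := hcomm hB hLB
  obtain ⟨z, hz⟩ := h P hP hPA hPB ((hPA.add_right hPB).smul_right t)
  refine or_iff_not_imp_left.2 fun hbot => ?_
  obtain ⟨v, hv, hv0⟩ := L.ne_bot_iff.1 hbot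
  have hz1 : z ≠ 0 := by
    rintro rfl
    exact hv0 (by rw [← hfix v hv, hz, zero_smul, zero_mulVec])
  refine L.eq_top_iff'.2 fun w => ?_
  have hw := L.smul_mem z⁻¹ (hmem w)
  rwa [hz, smul_mulVec, one_mulVec, smul_smul, inv_mul_cancel₀ hz1, one_smul] at hw

/-- An irreducible pair of Hermitian matrices together with a scalar in `[0, 1]`. -/
structure IrreducibleBlock where
  size : ℕ
  size_pos : 0 < size
  scale : ℝ
  scale_nonneg : 0 ≤ scale
  scale_le_one : scale ≤ 1
  A : Matrix (Fin size) (Fin size) ℂ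
  B : Matrix (Fin size) (Fin size) ℂ
  isHermitian_A : A.IsHermitian
  isHermitian_B : B.IsHermitian
  irreducible : ∀ L : Submodule ℂ (Fin size → ℂ),
    (∀ v ∈ L, A *ᵥ v ∈ L) → (∀ v ∈ L, B *ᵥ v ∈ L) → L = ⊥ ∨ L = ⊤

theorem exists_list_irreducibleBlock (n : ℕ) {A B C : Matrix (Fin n) (Fin n) ℂ}
    (hA : A.PosSemidef) (hB : B.PosSemidef) (hC : C.PosSemidef) (hABC : (A + B - C).PosSemidef) :
    ∃ l : List IrreducibleBlock, (l.map IrreducibleBlock.size).sum = n ∧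
      (l.map fun x => x.A.charpoly).prod = A.charpoly ∧
      (l.map fun x => x.B.charpoly).prod = B.charpoly ∧
      (l.map fun x => (x.scale • (x.A + x.B)).charpoly).prod = C.charpoly := by
  induction n using Nat.strong_induction_on with
  | _ n ih =>
  rcases n.eq_zero_or_pos with rfl | hn
  · exact ⟨[], by simp [Matrix.charpoly]⟩
  obtain ⟨t, ht⟩ := exists_isLeast_isDominatingScale hABC
  obtain ⟨ht01, U, hU, V, hV, W, hW, hpos⟩ := ht.1
  set A' := U * A * star U with hA'
  set B' := V * B * star V with hB'
  set C' := W * C * star W with hC'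
  have hA'pos : A'.PosSemidef := hA.mul_mul_conjTranspose_same U
  have hB'pos : B'.PosSemidef := hB.mul_mul_conjTranspose_same V
  have hC'pos : C'.PosSemidef := hC.mul_mul_conjTranspose_same W
  have hAchar : A'.charpoly = A.charpoly := charpoly_conj_unitary hU A
  have hBchar : B'.charpoly = B.charpoly := charpoly_conj_unitary hV B
  have hCchar : C'.charpoly = C.charpoly := charpoly_conj_unitary hW C
  by_cases hscal : HasScalarCommutant A' B' C'
  · have hleast : IsLeast {t | t ∈ Set.Icc (0 : ℝ) 1 ∧ IsDominatingScale A' B' C' t} t := by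
      refine ⟨⟨ht01, 1, one_mem _, 1, one_mem _, 1, one_mem _, by simpa using hpos⟩, ?_⟩
      rintro r ⟨hr, U', hU', V', hV', W', hW', hpos'⟩
      refine ht.2 ⟨hr, U' * U, mul_mem hU' hU, V' * V, mul_mem hV' hV, W' * W,
        mul_mem hW' hW, ?_⟩
      simpa only [hA', hB', hC', star_mul, mul_assoc] using hpos'
    have heq := hscal.eq_smul_add_of_isLeast hA'pos.isHermitian hB'pos.isHermitian hC'pos hpos
      hleast
    rw [heq] at hscal
    refine ⟨[⟨n, hn, t, ht01.1, ht01.2, A', B', hA'pos.isHermitian, hB'pos.isHermitian,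
      hscal.eq_bot_or_eq_top hA'pos.isHermitian hB'pos.isHermitian⟩], by simp,
      by simpa using hAchar, by simpa using hBchar, ?_⟩
    rw [← hCchar, heq, List.map_singleton, List.prod_singleton]
  · obtain ⟨k, l, hk, hl, hkl, P, Q, hPQ⟩ := exists_blocks_of_not_hasScalarCommutant hscal
    rw [Fintype.card_fin] at hkl
    have hle : (A' + B' - C').PosSemidef := by
      have h1 : (0 : ℝ) ≤ 1 - t := sub_nonneg.2 ht01.2
      convert hpos.add ((hA'pos.add hB'pos).smul h1) using 1
      module
    have hsub {m : ℕ} (P : Matrix (Fin n) (Fin m) ℂ) :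
        (Pᴴ * A' * P + Pᴴ * B' * P - Pᴴ * C' * P).PosSemidef := by
      simpa only [Matrix.mul_add, Matrix.mul_sub, Matrix.add_mul, Matrix.sub_mul]
        using hle.conjTranspose_mul_mul_same P
    obtain ⟨l₁, hs₁, hA₁, hB₁, hC₁⟩ := ih k (by omega) (hA'pos.conjTranspose_mul_mul_same P)
      (hB'pos.conjTranspose_mul_mul_same P) (hC'pos.conjTranspose_mul_mul_same P) (hsub P)
    obtain ⟨l₂, hs₂, hA₂, hB₂, hC₂⟩ := ih l (by omega) (hA'pos.conjTranspose_mul_mul_same Q)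
      (hB'pos.conjTranspose_mul_mul_same Q) (hC'pos.conjTranspose_mul_mul_same Q) (hsub Q)
    refine ⟨l₁ ++ l₂, ?_, ?_, ?_, ?_⟩
    · rw [List.map_append, List.sum_append, hs₁, hs₂, hkl]
    · rw [List.map_append, List.prod_append, hA₁, hA₂, ← hAchar, hPQ A' (by simp)]
    · rw [List.map_append, List.prod_append, hB₁, hB₂, ← hBchar, hPQ B' (by simp)]
    · rw [List.map_append, List.prod_append, hC₁, hC₂, ← hCchar, hPQ C' (by simp)]

end Decomposition

section Reindex

open Matrix Polynomial

theorem finSigmaFinEquiv_val_eq_sum_filter {s : ℕ} {nn : Fin s → ℕ}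
    (x : (l : Fin s) × Fin (nn l)) :
    (finSigmaFinEquiv x : ℕ) = ∑ l ∈ Finset.univ.filter (fun l' => l' < x.1), nn l + x.2 := by
  rw [finSigmaFinEquiv_apply]
  congr 1
  refine Finset.sum_bij (fun i _ => Fin.castLE x.1.2.le i) ?_ ?_ ?_ ?_
  · intro i _
    exact Finset.mem_filter.2 ⟨Finset.mem_univ _, i.2⟩
  · intro i _ j _ hij
    simpa [Fin.ext_iff] using hij
  · intro l hl
    exact ⟨⟨l, (Finset.mem_filter.1 hl).2⟩, Finset.mem_univ _, rfl⟩
  · intro i _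
    rfl

theorem prod_sigma_fin_eq {s : ℕ} (nn : Fin s → ℕ) (f : ℕ → ℂ[X]) :
    ∏ x : (l : Fin s) × Fin (nn l),
        f (∑ l ∈ Finset.univ.filter (fun l' => l' < x.1), nn l + x.2 + 1) =
      ∏ i : Fin (∑ l, nn l), f ((i : ℕ) + 1) :=
  Fintype.prod_equiv finSigmaFinEquiv _ _ fun x => by
    rw [finSigmaFinEquiv_val_eq_sum_filter]

/-- Eigenvalues of a matrix indexed by blocks, listed block after block. -/
theorem hasEigs_sigma_iff {s : ℕ} (nn : Fin s → ℕ) (a : ℕ → ℝ)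
    (M : Matrix ((l : Fin s) × Fin (nn l)) ((l : Fin s) × Fin (nn l)) ℂ) :
    HasEigs M (fun x => a (∑ l ∈ Finset.univ.filter (fun l' => l' < x.1), nn l + (x.2 : ℕ) + 1)) ↔
      M.IsHermitian ∧ M.charpoly = ∏ i : Fin (∑ l, nn l), (X - C (a ((i : ℕ) + 1) : ℂ)) := by
  rw [← prod_sigma_fin_eq nn fun i => X - C (a i : ℂ)]
  exact ⟨fun h => ⟨h.isHermitian, h.charpoly_eq⟩, fun h => h.1.hasEigs h.2⟩

theorem isHermitian_blockDiagonal' {s : ℕ} {nn : Fin s → ℕ}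
    {M : ∀ l, Matrix (Fin (nn l)) (Fin (nn l)) ℂ} (hM : ∀ l, (M l).IsHermitian) :
    (blockDiagonal' M).IsHermitian := by
  rw [IsHermitian, blockDiagonal'_conjTranspose]
  exact congr_arg _ (funext hM)

theorem posSemidef_blockDiagonal'_add_sub {s : ℕ} {nn : Fin s → ℕ} {t : Fin s → ℝ}
    (ht : ∀ l, 0 ≤ t l ∧ t l ≤ 1) {A B C : ∀ l, Matrix (Fin (nn l)) (Fin (nn l)) ℂ}
    (hC : ∀ l, C l = (t l : ℂ) • (A l + B l)) (hA : (blockDiagonal' A).PosSemidef)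
    (hB : (blockDiagonal' B).PosSemidef) :
    (blockDiagonal' A + blockDiagonal' B - blockDiagonal' C).PosSemidef := by
  let S : Matrix ((l : Fin s) × Fin (nn l)) ((l : Fin s) × Fin (nn l)) ℂ :=
    diagonal fun x => (√(1 - t x.1) : ℂ)
  convert (hA.add hB).mul_mul_conjTranspose_same S using 1
  ext ⟨i, i'⟩ ⟨j, j'⟩
  rw [diagonal_conjTranspose, mul_diagonal, diagonal_mul]
  rcases eq_or_ne i j with rfl | hij
  · have hsq : (√(1 - t i) : ℂ) * √(1 - t i) = 1 - t i := by
      rw [← Complex.ofReal_mul, Real.mul_self_sqrt (sub_nonneg.2 (ht i).2)]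
      simp
    simp only [Matrix.sub_apply, Matrix.add_apply, blockDiagonal'_apply_eq, hC, Matrix.smul_apply,
      smul_eq_mul, Pi.star_apply, RCLike.star_def, Complex.conj_ofReal]
    linear_combination -(A i i' j' + B i i' j') * hsq
  · simp [blockDiagonal'_apply_ne _ _ _ hij]

end Reindex

theorem stmt15 (n : ℕ) (hn : 0 < n) (a b c : ℕ → ℝ)
    (hamono : ∀ i j, 1 ≤ i → i ≤ j → j ≤ n → a j ≤ a i)
    (hbmono : ∀ i j, 1 ≤ i → i ≤ j → j ≤ n → b j ≤ b i)
    (hcmono : ∀ i j, 1 ≤ i → i ≤ j → j ≤ n → c j ≤ c i)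
    (hann : ∀ i, 1 ≤ i → i ≤ n → 0 ≤ a i)
    (hbnn : ∀ i, 1 ≤ i → i ≤ n → 0 ≤ b i)
    (hcnn : ∀ i, 1 ≤ i → i ≤ n → 0 ≤ c i) :
    (∃ A B C : Matrix (Fin n) (Fin n) ℂ,
        HasEigs A (fun i => a ((i : ℕ) + 1)) ∧
        HasEigs B (fun i => b ((i : ℕ) + 1)) ∧
        HasEigs C (fun i => c ((i : ℕ) + 1)) ∧
        (A + B - C).PosSemidef) ↔
    (∃ (s : ℕ) (_ : 1 ≤ s) (nn : Fin s → ℕ) (_ : ∀ ℓ, 0 < nn ℓ) (_ : ∑ ℓ, nn ℓ = n)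
        (t : Fin s → ℝ) (_ : ∀ ℓ, 0 ≤ t ℓ ∧ t ℓ ≤ 1)
        (A B C : (ℓ : Fin s) → Matrix (Fin (nn ℓ)) (Fin (nn ℓ)) ℂ),
        (∀ ℓ, (A ℓ).IsHermitian) ∧ (∀ ℓ, (B ℓ).IsHermitian) ∧ (∀ ℓ, (C ℓ).IsHermitian) ∧
        (∀ ℓ, C ℓ = (t ℓ : ℂ) • (A ℓ + B ℓ)) ∧
        (∀ ℓ, ∀ L : Submodule ℂ (Fin (nn ℓ) → ℂ),
          (∀ v ∈ L, (A ℓ).mulVec v ∈ L) → (∀ v ∈ L, (B ℓ).mulVec v ∈ L) →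
          L = ⊥ ∨ L = ⊤) ∧
        HasEigs (Matrix.blockDiagonal' A)
          (fun x => a ((∑ ℓ ∈ Finset.univ.filter (fun ℓ' => ℓ' < x.1), nn ℓ) + (x.2 : ℕ) + 1)) ∧
        HasEigs (Matrix.blockDiagonal' B)
          (fun x => b ((∑ ℓ ∈ Finset.univ.filter (fun ℓ' => ℓ' < x.1), nn ℓ) + (x.2 : ℕ) + 1)) ∧
        HasEigs (Matrix.blockDiagonal' C)
          (fun x => c ((∑ ℓ ∈ Finset.univ.filter (fun ℓ' => ℓ' < x.1), nn ℓ) + (x.2 : ℕ) + 1))) := by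
  constructor
  · rintro ⟨A, B, C, hA, hB, hC, hABC⟩
    obtain ⟨l, hsize, hlA, hlB, hlC⟩ := exists_list_irreducibleBlock n
      (hA.posSemidef fun i => hann _ (by omega) (by omega))
      (hB.posSemidef fun i => hbnn _ (by omega) (by omega))
      (hC.posSemidef fun i => hcnn _ (by omega) (by omega)) hABC
    rw [← Fin.sum_univ_fun_getElem] at hsize
    rw [← Fin.prod_univ_fun_getElem] at hlA hlB hlC
    have hlen : 1 ≤ l.length := by
      rw [Nat.one_le_iff_ne_zero]
      intro h0
      rw [List.length_eq_zero_iff] at h0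
      subst h0
      simp at hsize
      omega
    subst hsize
    have hCherm (x : IrreducibleBlock) : (x.scale • (x.A + x.B)).IsHermitian :=
      (x.isHermitian_A.add x.isHermitian_B).smul (IsSelfAdjoint.all x.scale)
    refine ⟨l.length, hlen, fun i => l[(i : ℕ)].size, fun i => l[(i : ℕ)].size_pos, rfl,
      fun i => l[(i : ℕ)].scale,
      fun i => ⟨l[(i : ℕ)].scale_nonneg, l[(i : ℕ)].scale_le_one⟩,
      fun i => l[(i : ℕ)].A, fun i => l[(i : ℕ)].B,
      fun i => l[(i : ℕ)].scale • (l[(i : ℕ)].A + l[(i : ℕ)].B),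
      fun i => l[(i : ℕ)].isHermitian_A, fun i => l[(i : ℕ)].isHermitian_B,
      fun i => hCherm _, fun i => (Complex.coe_smul _ _).symm, fun i => l[(i : ℕ)].irreducible,
      (hasEigs_sigma_iff _ _ _).2 ⟨?_, ?_⟩, (hasEigs_sigma_iff _ _ _).2 ⟨?_, ?_⟩,
      (hasEigs_sigma_iff _ _ _).2 ⟨?_, ?_⟩⟩
    · exact isHermitian_blockDiagonal' fun i => l[(i : ℕ)].isHermitian_A
    · rw [charpoly_blockDiagonal'_fin, ← hA.charpoly_eq]
      exact hlA
    · exact isHermitian_blockDiagonal' fun i => l[(i : ℕ)].isHermitian_B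
    · rw [charpoly_blockDiagonal'_fin, ← hB.charpoly_eq]
      exact hlB
    · exact isHermitian_blockDiagonal' fun i => hCherm _
    · rw [charpoly_blockDiagonal'_fin, ← hC.charpoly_eq]
      exact hlC
  · rintro ⟨s, -, nn, -, rfl, t, ht, A, B, C, -, -, -, hC, -, hAe, hBe, hCe⟩
    have hpos {d : ℕ → ℝ} (hd : ∀ i, 1 ≤ i → i ≤ ∑ l, nn l → 0 ≤ d i)
        {M : Matrix ((l : Fin s) × Fin (nn l)) ((l : Fin s) × Fin (nn l)) ℂ}
        (hM : HasEigs M fun x =>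
          d (∑ l ∈ Finset.univ.filter (fun l' => l' < x.1), nn l + (x.2 : ℕ) + 1)) :
        M.PosSemidef := by
      refine hM.posSemidef fun x => hd _ (by omega) ?_
      rw [← finSigmaFinEquiv_val_eq_sum_filter]
      exact (finSigmaFinEquiv x).2
    have hreindex {d : ℕ → ℝ}
        {M : Matrix ((l : Fin s) × Fin (nn l)) ((l : Fin s) × Fin (nn l)) ℂ}
        (hM : HasEigs M fun x =>
          d (∑ l ∈ Finset.univ.filter (fun l' => l' < x.1), nn l + (x.2 : ℕ) + 1)) :
        HasEigs (Matrix.reindex finSigmaFinEquiv finSigmaFinEquiv M)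
          (fun i => d ((i : ℕ) + 1)) := by
      obtain ⟨hherm, hchar⟩ := (hasEigs_sigma_iff _ _ _).1 hM
      exact Matrix.IsHermitian.hasEigs (hherm.submatrix _)
        ((Matrix.charpoly_reindex _ _).trans hchar)
    refine ⟨_, _, _, hreindex hAe, hreindex hBe, hreindex hCe, ?_⟩
    have hABC := posSemidef_blockDiagonal'_add_sub ht hC (hpos hann hAe) (hpos hbnn hBe)
    exact hABC.submatrix finSigmaFinEquiv.symm
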